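/- arXiv:1709.06168 — 2 statements merged into one kernel-verified Lean document; each statement's English description precedes it below -/
import Mathlib

section
/- Let n₁,…,n_ℓ be natural numbers and let p be a prime such that p divides n_j for some index j but p does not divide n_i for any i ≠ j. Then B(n₁,…,n_j,…,n_ℓ) = (1/p) · B(n₁,…,n_j/p,…,n_ℓ), i.e. replacing n_j by n_j/p multiplies the value by p. -/
open scoped Classical Real
open Complex MeasureTheory

/-- The sawtooth function `ψ`. -/
noncomputable def saw (x : ℝ) : ℝ := if Int.fract x = 0 then 0 else Int.fract x - 1/2

/-- The correlation `B(n₁, …, n_ℓ)` of sawtooth functions. -/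
noncomputable def Bcorr {l : ℕ} (n : Fin l → ℕ) : ℝ :=
  (1 / ∏ j, (n j : ℝ)) * ∫ x in (0 : ℝ)..(∏ j, (n j : ℝ)), ∏ j, saw (x / n j)

lemma saw_periodic : Function.Periodic saw 1 := fun x => by
  simp [saw, Int.fract_add_one]

lemma saw_add_intCast (x : ℝ) (z : ℤ) : saw (x + z) = saw x := by
  simpa using saw_periodic.int_mul z x

lemma saw_add_natCast (x : ℝ) (m : ℕ) : saw (x + m) = saw x := by
  simpa using saw_periodic.nat_mul m x

lemma saw_zero : saw 0 = 0 := by simp [saw]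

lemma saw_of_pos_of_lt_one {x : ℝ} (h0 : 0 < x) (h1 : x < 1) : saw x = x - 1 / 2 := by
  have : Int.fract x = x := Int.fract_eq_self.2 ⟨h0.le, h1⟩
  simp [saw, this, h0.ne']

lemma abs_saw_le_one (x : ℝ) : |saw x| ≤ 1 := by
  unfold saw
  split_ifs
  · simp
  · rw [abs_le]
    constructor <;> linarith [Int.fract_nonneg x, Int.fract_lt_one x]

lemma measurable_saw : Measurable saw :=
  Measurable.ite (measurableSet_eq_fun measurable_fract measurable_const) measurable_const
    (measurable_fract.sub_const _)

/-- The distribution relation of `saw` on the fundamental domain `0 ≤ r < 1`. -/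
lemma sum_range_saw_add_div {p : ℕ} (hp : 0 < p) {r : ℝ} (h0 : 0 ≤ r) (h1 : r < 1) :
    ∑ k ∈ Finset.range p, saw ((r + k) / p) = saw r := by
  have hp' : (0 : ℝ) < p := by exact_mod_cast hp
  have hlt : ∀ k ∈ Finset.range p, (r + k) / p < 1 := fun k hk => by
    rw [div_lt_one hp']
    have : ((k + 1 : ℕ) : ℝ) ≤ p := by exact_mod_cast Finset.mem_range.1 hk
    push_cast at this
    linarith
  have gauss : ∀ q : ℕ, ∑ k ∈ Finset.range q, (k : ℝ) = q * (q - 1) / 2 := fun q => by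
    induction q with
    | zero => simp
    | succ q ih => rw [Finset.sum_range_succ, ih]; push_cast; ring
  rcases h0.eq_or_lt with rfl | hr
  · obtain ⟨q, rfl⟩ : ∃ q, p = q + 1 := ⟨p - 1, by omega⟩
    rw [Finset.sum_range_succ']
    have : ∀ k ∈ Finset.range q, saw ((0 + ((k + 1 : ℕ) : ℝ)) / (q + 1 : ℕ))
        = ((k : ℝ) + 1) / (q + 1) - 1 / 2 := fun k hk => by
      rw [saw_of_pos_of_lt_one (by positivity)
        (hlt (k + 1) (by simpa using hk))]
      push_cast
      ring
    rw [Finset.sum_congr rfl this, Finset.sum_sub_distrib, ← Finset.sum_div,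
      Finset.sum_add_distrib, gauss]
    simp only [Finset.sum_const, Finset.card_range, nsmul_eq_mul, Nat.cast_zero, add_zero,
      zero_div, saw_zero]
    field_simp
    ring
  · have : ∀ k ∈ Finset.range p, saw ((r + k) / p) = (r + k) / p - 1 / 2 := fun k hk =>
      saw_of_pos_of_lt_one (by positivity) (hlt k hk)
    rw [Finset.sum_congr rfl this, Finset.sum_sub_distrib, ← Finset.sum_div,
      Finset.sum_add_distrib, gauss, saw_of_pos_of_lt_one hr h1]
    simp only [Finset.sum_const, Finset.card_range, nsmul_eq_mul]
    field_simp
    ring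

lemma sum_range_saw_add_mul_div {p M : ℕ} (hp : 0 < p) (hM : M.Coprime p) (y : ℝ) :
    ∑ k ∈ Finset.range p, saw ((y + k * M) / p) = saw y := by
  have : NeZero p := ⟨hp.ne'⟩
  have hp' : (p : ℝ) ≠ 0 := by exact_mod_cast hp.ne'
  have sum_zmod : ∀ F : ZMod p → ℝ, ∑ k ∈ Finset.range p, F k = ∑ a, F a := fun F =>
    Finset.sum_nbij' (fun k => (k : ZMod p)) ZMod.val (by simp)
      (fun a _ => by simpa using ZMod.val_lt a)
      (fun k hk => ZMod.val_cast_of_lt (by simpa using hk)) (by simp) (by simp)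
  set r := Int.fract y
  set q := ⌊y⌋
  have hy : y = r + q := (Int.fract_add_floor y).symm
  let F : ZMod p → ℝ := fun a => saw ((r + a.val) / p)
  have hF : ∀ z : ℤ, saw ((r + z) / p) = F z := fun z => by
    have h1 : (((z : ZMod p).val : ℤ)) = z % p := ZMod.val_intCast z
    have h2 : (z : ℝ) = ((z : ZMod p).val : ℝ) + p * ((z / p : ℤ) : ℝ) := by
      have := Int.emod_add_mul_ediv z p
      rw [← h1] at this
      exact_mod_cast this.symm
    rw [h2, show (r + (((z : ZMod p).val : ℝ) + p * ((z / p : ℤ) : ℝ))) / p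
      = (r + ((z : ZMod p).val : ℝ)) / p + ((z / p : ℤ) : ℝ) by field_simp; ring,
      saw_add_intCast]
  have hunit : IsUnit (M : ZMod p) := (ZMod.isUnit_iff_coprime M p).2 hM
  have hbij : Function.Bijective fun a : ZMod p => (q : ZMod p) + a * M :=
    Finite.injective_iff_bijective.1 fun a b h => hunit.mul_right_cancel (add_left_cancel h)
  calc ∑ k ∈ Finset.range p, saw ((y + k * M) / p)
      = ∑ k ∈ Finset.range p, F ((q : ZMod p) + (k : ZMod p) * M) := by
        refine Finset.sum_congr rfl fun k _ => ?_
        have := hF (q + k * M)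
        push_cast at this
        rw [← this, hy, add_assoc]
    _ = ∑ a, F a := by
        rw [sum_zmod fun a => F ((q : ZMod p) + a * M)]
        exact hbij.sum_comp F
    _ = ∑ k ∈ Finset.range p, saw ((r + k) / p) := by
        rw [← sum_zmod]
        refine Finset.sum_congr rfl fun k hk => ?_
        simp only [F, ZMod.val_cast_of_lt (Finset.mem_range.1 hk)]
    _ = saw y := by
        rw [sum_range_saw_add_div hp (Int.fract_nonneg y) (Int.fract_lt_one y),
          ← saw_add_intCast r q, ← hy]

lemma intervalIntegrable_prod_saw {ι : Type*} (s : Finset ι) (n : ι → ℕ) (a b : ℝ) :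
    IntervalIntegrable (fun x => ∏ i ∈ s, saw (x / n i)) volume a b := by
  refine (intervalIntegrable_const (c := (1 : ℝ))).mono_fun' ?_ (ae_of_all _ fun x => ?_)
  · exact (Finset.measurable_fun_prod s fun i _ =>
      measurable_saw.comp (measurable_id.div_const _)).aestronglyMeasurable
  · simp only [Real.norm_eq_abs, Finset.abs_prod]
    exact Finset.prod_le_one (fun _ _ => abs_nonneg _) fun _ _ => abs_saw_le_one _

lemma intervalIntegral_zero_natCast_mul {f : ℝ → ℝ}
    (hf : ∀ a b, IntervalIntegrable f volume a b) (p : ℕ) (T : ℝ) :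
    ∫ x in (0 : ℝ)..(p * T), f x = ∫ x in (0 : ℝ)..T, ∑ k ∈ Finset.range p, f (x + k * T) := by
  rw [intervalIntegral.integral_finsetSum]
  · have := intervalIntegral.sum_integral_adjacent_intervals (μ := volume) (f := f)
      (a := fun k : ℕ => k * T) (n := p) fun k _ => hf _ _
    simp only [Nat.cast_zero, zero_mul] at this
    rw [← this]
    refine Finset.sum_congr rfl fun k _ => ?_
    rw [intervalIntegral.integral_comp_add_right]
    push_cast
    ring_nf
  · intro k _
    simpa using (hf (0 + k * T) (T + k * T)).comp_add_right (k * T)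

/-- Proposition 3.1, part 2: removing a prime dividing exactly one of the `n_j`. -/
theorem Bcorr_remove_prime {l : ℕ} (n : Fin l → ℕ) (hn : ∀ i, 0 < n i)
    (p : ℕ) (hp : p.Prime) (j : Fin l) (hpj : p ∣ n j)
    (hpi : ∀ i, i ≠ j → ¬ p ∣ n i) :
    Bcorr n = (1 / p : ℝ) * Bcorr (Function.update n j (n j / p)) := by
  obtain ⟨m, hm⟩ := hpj
  have hm0 : (m : ℝ) ≠ 0 := by
    rintro h
    have := hn j
    simp_all
  have hp0 : (p : ℝ) ≠ 0 := by exact_mod_cast hp.ne_zero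
  have hdiv : n j / p = m := by rw [hm, Nat.mul_div_cancel_left _ hp.pos]
  rw [hdiv]
  set s := Finset.univ.erase j
  set M : ℕ := ∏ i ∈ s, n i with hM
  have hcop : M.Coprime p := Nat.Coprime.prod_left fun i hi =>
    ((hp.coprime_iff_not_dvd).2 (hpi i (Finset.ne_of_mem_erase hi))).symm
  have hsplit : ∀ g : Fin l → ℝ, ∏ i, g i = g j * ∏ i ∈ s, g i := fun g =>
    (Finset.mul_prod_erase _ g (Finset.mem_univ j)).symm
  have hupd : ∀ g : ℕ → ℝ,
      ∏ i, g (Function.update n j m i) = g m * ∏ i ∈ s, g (n i) := fun g => by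
    rw [hsplit, Function.update_self]
    congr 1
    refine Finset.prod_congr rfl fun i hi => ?_
    rw [Function.update_of_ne (Finset.ne_of_mem_erase hi)]
  have hN : ∏ i, (n i : ℝ) = p * (m * M) := by
    rw [hsplit, hm, hM]
    push_cast
    ring
  have hT : ∏ i, ((Function.update n j m i : ℕ) : ℝ) = m * M := by
    rw [hupd fun k => (k : ℝ), hM]
    push_cast
    rfl
  have hshift : ∀ x : ℝ, ∀ k : ℕ, ∀ i ∈ s,
      saw ((x + k * (m * M)) / n i) = saw (x / n i) := fun x k i hi => by
    obtain ⟨c, hc⟩ : n i ∣ M := Finset.dvd_prod_of_mem _ hi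
    have hni : (n i : ℝ) ≠ 0 := by exact_mod_cast (hn i).ne'
    rw [hc, ← saw_add_natCast (x / n i) (k * (m * c))]
    congr 1
    push_cast
    field_simp
  have hsum : ∀ x : ℝ, ∑ k ∈ Finset.range p, ∏ i, saw ((x + k * (m * M)) / n i)
      = ∏ i, saw (x / (Function.update n j m i : ℕ)) := fun x => by
    rw [hupd fun k => saw (x / k), ← sum_range_saw_add_mul_div hp.pos hcop (x / m),
      Finset.sum_mul]
    refine Finset.sum_congr rfl fun k _ => ?_
    rw [hsplit, Finset.prod_congr rfl (hshift x k), hm]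
    congr 2
    push_cast
    field_simp
  unfold Bcorr
  rw [hN, hT, intervalIntegral_zero_natCast_mul (intervalIntegrable_prod_saw _ n)]
  simp only [hsum]
  rw [← mul_assoc (1 / (p : ℝ)), one_div_mul_one_div]
end

section
/- There is an absolute constant A such that the following holds. Let q be a prime and let n₁,…,n_ℓ be natural numbers each coprime to q; set K = n₁⋯n_ℓ / min(n₁,…,n_ℓ). If K < q/ℓ, then |(1/q) Σ_{k=0}^{q−1} ψ(k·n̄₁/q)⋯ψ(k·n̄_ℓ/q) − B(n₁,…,n_ℓ)| ≤ A · (ℓK/q) · log(e·q/K), where n̄_j denotes the multiplicative inverse of n_j mod q. -/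
open scoped Classical Real
open Complex MeasureTheory

/-- The least nonnegative residue of the multiplicative inverse of `n` mod `q`. -/
noncomputable def invMod (q n : ℕ) : ℕ := ZMod.val ((n : ZMod q)⁻¹)

lemma saw_eq (x : ℝ) : saw x = x - ((⌊x⌋ : ℝ) + ⌈x⌉) / 2 := by
  unfold saw
  split_ifs with h
  · have hx : (⌊x⌋ : ℝ) = x := by rw [Int.fract] at h; linarith
    have hc : ⌈x⌉ = ⌊x⌋ := by rw [← hx, Int.ceil_intCast, Int.floor_intCast]
    rw [hc, hx]; ring
  · have hc : (⌈x⌉ : ℝ) = x + 1 - Int.fract x := Int.ceil_eq_add_one_sub_fract h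
    rw [hc, Int.fract]; ring

lemma saw_add_int (x : ℝ) (m : ℤ) : saw (x + m) = saw x := by
  simp only [saw, Int.fract_add_intCast]

/-- A monotone function whose increments dominate those of `saw`. -/
noncomputable def sawVariation (x : ℝ) : ℝ := x + ((⌊x⌋ : ℝ) + ⌈x⌉) / 2

lemma sawVariation_natCast (m : ℕ) : sawVariation m = 2 * m := by
  simp only [sawVariation, Int.floor_natCast, Int.ceil_natCast, Int.cast_natCast]; ring

lemma abs_saw_sub_le {u v w : ℝ} (huv : u ≤ v) (hvw : v ≤ w) :
    |saw u - saw v| ≤ sawVariation w - sawVariation u := by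
  have h1 : (⌊u⌋ : ℝ) ≤ ⌊v⌋ := by exact_mod_cast Int.floor_mono huv
  have h2 : (⌈u⌉ : ℝ) ≤ ⌈v⌉ := by exact_mod_cast Int.ceil_mono huv
  have h3 : (⌊v⌋ : ℝ) ≤ ⌊w⌋ := by exact_mod_cast Int.floor_mono hvw
  have h4 : (⌈v⌉ : ℝ) ≤ ⌈w⌉ := by exact_mod_cast Int.ceil_mono hvw
  rw [saw_eq, saw_eq, sawVariation, sawVariation, abs_le]
  constructor <;> linarith

lemma abs_prod_le_one {ι : Type*} (s : Finset ι) (a : ι → ℝ) (ha : ∀ i, |a i| ≤ 1) :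
    |∏ i ∈ s, a i| ≤ 1 := by
  rw [Finset.abs_prod]
  exact Finset.prod_le_one (fun i _ => abs_nonneg _) fun i _ => ha i

lemma abs_prod_sub_prod_le {ι : Type*} (s : Finset ι) (a b : ι → ℝ)
    (ha : ∀ i, |a i| ≤ 1) (hb : ∀ i, |b i| ≤ 1) :
    |∏ i ∈ s, a i - ∏ i ∈ s, b i| ≤ ∑ i ∈ s, |a i - b i| := by
  induction s using Finset.induction_on with
  | empty => simp
  | insert i s hi ih =>
    rw [Finset.prod_insert hi, Finset.prod_insert hi, Finset.sum_insert hi]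
    have hpa := abs_prod_le_one s a ha
    calc |a i * ∏ j ∈ s, a j - b i * ∏ j ∈ s, b j|
        = |(a i - b i) * ∏ j ∈ s, a j + b i * (∏ j ∈ s, a j - ∏ j ∈ s, b j)| := by
          congr 1; ring
      _ ≤ |a i - b i| * |∏ j ∈ s, a j| + |b i| * |∏ j ∈ s, a j - ∏ j ∈ s, b j| := by
          rw [← abs_mul, ← abs_mul]; exact abs_add_le _ _
      _ ≤ |a i - b i| * 1 + 1 * |∏ j ∈ s, a j - ∏ j ∈ s, b j| := by
          gcongr; exact hb i
      _ ≤ _ := by linarith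

lemma intervalIntegrable_prod_saw_s18 {l : ℕ} (c : Fin l → ℕ) (a b : ℝ) :
    IntervalIntegrable (fun t : ℝ => ∏ j, saw (c j * t)) volume a b := by
  refine (intervalIntegrable_const (c := (1 : ℝ))).mono_fun ?_ ?_
  · exact (Finset.measurable_prod _ fun j _ =>
      measurable_saw.comp (measurable_const_mul (c j : ℝ))).aestronglyMeasurable
  · refine Filter.Eventually.of_forall fun t => ?_
    exact (abs_prod_le_one Finset.univ _ fun j => abs_saw_le_one (c j * t)).trans_eq abs_one.symm

/-- The equally spaced Riemann sum of a product of dilated sawtooth functions is close to the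
integral over a period. -/
lemma abs_riemannSum_sub_integral_le {l : ℕ} (c : Fin l → ℕ) {q : ℕ} (hq : 0 < q) :
    |(1 / q : ℝ) * ∑ k ∈ Finset.range q, ∏ j, saw (c j * (k / q)) -
      ∫ t in (0 : ℝ)..1, ∏ j, saw (c j * t)| ≤ (1 / q : ℝ) * ∑ j, 2 * (c j : ℝ) := by
  have hq' : (0 : ℝ) < q := by exact_mod_cast hq
  let f : ℝ → ℝ := fun t => ∏ j, saw (c j * t)
  have hf : ∀ a b, IntervalIntegrable f volume a b := intervalIntegrable_prod_saw_s18 c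
  set p : ℕ → ℝ := fun k => (k : ℝ) / q with hp
  have hstep : ∀ k, p (k + 1) - p k = 1 / q := fun k => by
    simp only [hp]; push_cast; ring
  have hle : ∀ k, p k ≤ p (k + 1) := fun k => by
    have := hstep k
    have : (0 : ℝ) < 1 / q := by positivity
    linarith
  have hsplit : ∫ t in (0 : ℝ)..1, f t = ∑ k ∈ Finset.range q, ∫ t in (p k)..(p (k + 1)), f t := by
    rw [intervalIntegral.sum_integral_adjacent_intervals
      fun k _ => hf _ _]
    simp [hp, hq'.ne']
  have hpiece : ∀ k, |(1 / q : ℝ) * f (p k) - ∫ t in (p k)..(p (k + 1)), f t| ≤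
      (1 / q : ℝ) * ∑ j, (sawVariation (c j * p (k + 1)) - sawVariation (c j * p k)) := by
    intro k
    have h1 : (1 / q : ℝ) * f (p k) = ∫ _ in (p k)..(p (k + 1)), f (p k) := by
      rw [intervalIntegral.integral_const, hstep, smul_eq_mul]
    rw [h1, ← intervalIntegral.integral_sub intervalIntegrable_const (hf _ _)]
    have h2 := intervalIntegral.norm_integral_le_of_norm_le_const (a := p k) (b := p (k + 1))
      (f := fun t => f (p k) - f t)
      (C := ∑ j, (sawVariation (c j * p (k + 1)) - sawVariation (c j * p k))) ?_
    · rwa [Real.norm_eq_abs, hstep, abs_of_pos (one_div_pos.mpr hq'), mul_comm] at h2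
    · intro t ht
      rw [Set.uIoc_of_le (hle k)] at ht
      refine (abs_prod_sub_prod_le _ _ _ (fun _ => abs_saw_le_one _)
        fun _ => abs_saw_le_one _).trans (Finset.sum_le_sum fun j _ => ?_)
      exact abs_saw_sub_le (mul_le_mul_of_nonneg_left ht.1.le (Nat.cast_nonneg _))
        (mul_le_mul_of_nonneg_left ht.2 (Nat.cast_nonneg _))
  change |(1 / q : ℝ) * ∑ k ∈ Finset.range q, f (p k) - ∫ t in (0 : ℝ)..1, f t| ≤ _
  rw [hsplit, Finset.mul_sum, ← Finset.sum_sub_distrib]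
  refine (Finset.abs_sum_le_sum_abs _ _).trans
    ((Finset.sum_le_sum fun k _ => hpiece k).trans (le_of_eq ?_))
  rw [← Finset.mul_sum, Finset.sum_comm]
  congr 1
  refine Finset.sum_congr rfl fun j _ => ?_
  rw [Finset.sum_range_sub fun k => sawVariation (c j * p k)]
  have h0 : (c j : ℝ) * p 0 = (0 : ℕ) := by simp [hp]
  have h1 : (c j : ℝ) * p q = c j := by simp [hp, hq'.ne']
  rw [h0, h1, sawVariation_natCast, sawVariation_natCast]
  simp

lemma Bcorr_eq_integral {l : ℕ} (n : Fin l → ℕ) (hn : ∀ j, n j ≠ 0) :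
    Bcorr n = ∫ t in (0 : ℝ)..1,
      ∏ j, saw (((∏ i ∈ Finset.univ.erase j, n i : ℕ) : ℝ) * t) := by
  have hn' : ∀ j, (n j : ℝ) ≠ 0 := fun j => by exact_mod_cast hn j
  have hN : (∏ j, (n j : ℝ)) ≠ 0 := Finset.prod_ne_zero_iff.mpr fun j _ => hn' j
  have hsub := intervalIntegral.integral_comp_mul_left (a := 0) (b := 1)
    (fun x : ℝ => ∏ j, saw (x / n j)) hN
  rw [mul_zero, mul_one, smul_eq_mul] at hsub
  rw [Bcorr, one_div, ← hsub]
  congr 1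
  funext t
  refine Finset.prod_congr rfl fun j _ => ?_
  congr 1
  rw [← Finset.mul_prod_erase Finset.univ (fun i => (n i : ℝ)) (Finset.mem_univ j)]
  push_cast
  field_simp [hn' j]

lemma saw_natCast_div_eq_val {q : ℕ} [NeZero q] (a : ℕ) :
    saw ((a : ℝ) / q) = saw (((a : ZMod q).val : ℝ) / q) := by
  have hq : (q : ℝ) ≠ 0 := Nat.cast_ne_zero.mpr (NeZero.ne q)
  rw [ZMod.val_natCast]
  have h : (a : ℝ) / q = ((a % q : ℕ) : ℝ) / q + ((a / q : ℕ) : ℤ) := by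
    have : (a : ℝ) = (a % q : ℕ) + q * (a / q : ℕ) := by exact_mod_cast (Nat.mod_add_div a q).symm
    rw [Int.cast_natCast]
    field_simp
    linarith
  rw [h, saw_add_int]

lemma sum_range_natCast_zmod {q : ℕ} [NeZero q] (F : ZMod q → ℝ) :
    ∑ k ∈ Finset.range q, F k = ∑ z, F z := by
  refine Finset.sum_bij' (fun k _ => (k : ZMod q)) (fun z _ => z.val) ?_ ?_ ?_ ?_ ?_
  · simp
  · intro z _; exact Finset.mem_range.mpr (ZMod.val_lt z)
  · intro k hk; exact ZMod.val_cast_of_lt (Finset.mem_range.mp hk)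
  · intro z _; exact ZMod.natCast_zmod_val z
  · simp

/-- The change of variables `k ↦ (n₁ ⋯ n_ℓ) k` modulo `q`. -/
lemma sum_prod_saw_invMod {q : ℕ} (hq : q.Prime) {l : ℕ} (n : Fin l → ℕ)
    (hn : ∀ j, Nat.Coprime (n j) q) :
    ∑ k ∈ Finset.range q, (∏ j, saw (((k * invMod q (n j) : ℕ) : ℝ) / q)) =
      ∑ k ∈ Finset.range q,
        ∏ j, saw (((∏ i ∈ Finset.univ.erase j, n i : ℕ) : ℝ) * (k / q)) := by
  have : Fact q.Prime := ⟨hq⟩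
  have hn0 : ∀ j, (n j : ZMod q) ≠ 0 := fun j h => by
    rw [ZMod.natCast_eq_zero_iff] at h
    exact hq.one_lt.ne' (Nat.eq_one_of_dvd_coprimes (hn j) h dvd_rfl)
  have hN : (∏ j, (n j : ZMod q)) ≠ 0 := Finset.prod_ne_zero_iff.mpr fun j _ => hn0 j
  let F : ZMod q → ℝ := fun z => ∏ j, saw (((z * (n j : ZMod q)⁻¹).val : ℝ) / q)
  have hL : ∀ k : ℕ, ∏ j, saw (((k * invMod q (n j) : ℕ) : ℝ) / q) = F k := fun k => by
    refine Finset.prod_congr rfl fun j _ => ?_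
    rw [saw_natCast_div_eq_val, Nat.cast_mul, invMod, ZMod.natCast_zmod_val]
  have hR : ∀ k : ℕ, ∏ j, saw (((∏ i ∈ Finset.univ.erase j, n i : ℕ) : ℝ) * (k / q)) =
      F ((∏ j, (n j : ZMod q)) * k) := fun k => by
    refine Finset.prod_congr rfl fun j _ => ?_
    rw [← mul_div_assoc, ← Nat.cast_mul, saw_natCast_div_eq_val,
      ← Finset.mul_prod_erase Finset.univ (fun i => (n i : ZMod q)) (Finset.mem_univ j)]
    congr 4
    push_cast
    have := hn0 j
    field_simp
  simp_rw [hL, hR]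
  rw [sum_range_natCast_zmod F,
    sum_range_natCast_zmod fun z => F ((∏ j, (n j : ZMod q)) * z)]
  exact (Equiv.sum_comp (Equiv.mulLeft₀ _ hN) F).symm

/-- Proposition 3.2: discrete correlations of sawtooth functions at inverses mod `q`
are close to `B(n₁,…,n_ℓ)`. -/
theorem discrete_sawtooth_correlation :
    ∃ A : ℝ, ∀ q : ℕ, q.Prime → ∀ l : ℕ, ∀ hl : 0 < l, ∀ n : Fin l → ℕ,
      (∀ j, Nat.Coprime (n j) q) →
      ∀ K : ℝ,
        K = (∏ j, (n j : ℝ)) /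
          (Finset.univ.inf' (Finset.univ_nonempty_iff.mpr ⟨⟨0, hl⟩⟩)
            fun j => (n j : ℝ)) →
        K < (q : ℝ) / l →
        |(1 / q : ℝ) * ∑ k ∈ Finset.range q,
            (∏ j, saw (((k * invMod q (n j) : ℕ) : ℝ) / q)) - Bcorr n| ≤
          A * ((l : ℝ) * K / q) * Real.log (Real.exp 1 * q / K) := by
  refine ⟨2, ?_⟩
  intro q hq l hl n hn K hK hKq
  have hq0 : (0 : ℝ) < q := by exact_mod_cast hq.pos
  have hl1 : (1 : ℝ) ≤ l := by exact_mod_cast hl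
  have hn0 : ∀ j, 0 < n j := fun j => Nat.pos_of_ne_zero fun h => by
    have := hn j
    rw [h, Nat.coprime_zero_left] at this
    exact hq.one_lt.ne' this
  have hn' : ∀ j, (0 : ℝ) < n j := fun j => by exact_mod_cast hn0 j
  have hNpos : (0 : ℝ) < ∏ j, (n j : ℝ) := Finset.prod_pos fun j _ => hn' j
  have hmin : (0 : ℝ) < Finset.univ.inf' (Finset.univ_nonempty_iff.mpr ⟨⟨0, hl⟩⟩)
      fun j => (n j : ℝ) := by
    rw [Finset.lt_inf'_iff]; exact fun j _ => hn' j
  have hKpos : 0 < K := hK ▸ div_pos hNpos hmin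
  have hcK : ∀ j, ((∏ i ∈ Finset.univ.erase j, n i : ℕ) : ℝ) ≤ K := fun j => by
    rw [hK, le_div_iff₀ hmin,
      ← Finset.mul_prod_erase Finset.univ (fun i => (n i : ℝ)) (Finset.mem_univ j),
      Nat.cast_prod, mul_comm]
    exact mul_le_mul_of_nonneg_right (Finset.inf'_le _ (Finset.mem_univ j)) (by positivity)
  have hlog : 1 ≤ Real.log (Real.exp 1 * q / K) := by
    rw [Real.le_log_iff_exp_le (by positivity), le_div_iff₀ hKpos]
    have : K ≤ q := hKq.le.trans (div_le_self hq0.le hl1)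
    gcongr
  rw [sum_prod_saw_invMod hq n hn, Bcorr_eq_integral n fun j => (hn0 j).ne']
  refine (abs_riemannSum_sub_integral_le _ hq.pos).trans ?_
  calc (1 / q : ℝ) * ∑ j, 2 * ((∏ i ∈ Finset.univ.erase j, n i : ℕ) : ℝ)
      ≤ (1 / q : ℝ) * ∑ _j : Fin l, 2 * K := by
        gcongr with j _
        exact hcK j
    _ = 2 * ((l : ℝ) * K / q) * 1 := by
        rw [Finset.sum_const, Finset.card_univ, Fintype.card_fin, nsmul_eq_mul]; ring
    _ ≤ _ := by gcongr
end
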